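/- arXiv:2505.11380 — 4 statements merged into one kernel-verified Lean document; each statement's English description precedes it below -/
import Mathlib

section
/- Let ĥ : X → Bool be a crisp classifier and split D into D⁺ = {x ∈ D : ĥ(x) = true} and D⁻ = {x ∈ D : ĥ(x) = false}. If h̃⁺ : X → ℝ is perfectly calibrated with respect to D⁺ and h̃⁻ : X → ℝ is perfectly calibrated with respect to D⁻, then (Σ_{x ∈ D⁺} h̃⁺(x) + Σ_{x ∈ D⁻} (1 − h̃⁻(x))) / |D| = |{x ∈ D : ĥ(x) = Φ(x)}| / |D|, i.e., the calibration-based estimator equals the classification accuracy of ĥ on D. -/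
theorem calib_sum_aux {X : Type*} (S : Finset X) (Φ : X → Bool) (h : X → ℝ)
    (hcal : ∀ x ∈ S, h x =
      ((S.filter (fun x' => Φ x' = true ∧ h x' = h x)).card : ℝ) /
      ((S.filter (fun x' => h x' = h x)).card : ℝ)) :
    ∑ x ∈ S, h x = ((S.filter (fun x => Φ x = true)).card : ℝ) := by
  classical
  have hm : ∀ x ∈ S, h x ∈ S.image h := fun x hx => Finset.mem_image_of_mem h hx
  have e2 : ((S.filter (fun x => Φ x = true)).card : ℝ)
      = ∑ x ∈ S, if Φ x = true then (1 : ℝ) else 0 := by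
    rw [Finset.sum_boole]
  rw [e2, ← Finset.sum_fiberwise_of_maps_to hm, ← Finset.sum_fiberwise_of_maps_to hm]
  refine Finset.sum_congr rfl fun v hv => ?_
  obtain ⟨x, hx, rfl⟩ := Finset.mem_image.1 hv
  have hpos : ((S.filter (fun x' => h x' = h x)).card : ℝ) ≠ 0 := by
    have : (S.filter (fun x' => h x' = h x)).Nonempty := ⟨x, by simp [hx]⟩
    exact_mod_cast this.card_pos.ne'
  have hk := hcal x hx
  rw [eq_div_iff hpos] at hk
  rw [Finset.sum_congr rfl (g := fun _ => h x) (fun y hy => (Finset.mem_filter.1 hy).2),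
    Finset.sum_const, nsmul_eq_mul, mul_comm, hk, Finset.sum_boole, Finset.filter_filter]
  simp only [and_comm]

/-- Split `D` by the crisp classifier `hc` into predicted positives
`D.filter (hc · = true)` and predicted negatives `D.filter (hc · = false)`.  If `htp` is
perfectly calibrated w.r.t. the former and `htm` w.r.t. the latter, then the
calibration-based estimator equals the classification accuracy of `hc` on `D`. -/
theorem calibrated_estimator_eq_accuracy {X : Type*} (D : Finset X) (hD : D.Nonempty)
    (Φ : X → Bool) (hc : X → Bool) (htp htm : X → ℝ)
    (hcalp : ∀ x ∈ D.filter (fun y => hc y = true), htp x =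
      (((D.filter (fun y => hc y = true)).filter
          (fun x' => Φ x' = true ∧ htp x' = htp x)).card : ℝ) /
      (((D.filter (fun y => hc y = true)).filter (fun x' => htp x' = htp x)).card : ℝ))
    (hcalm : ∀ x ∈ D.filter (fun y => hc y = false), htm x =
      (((D.filter (fun y => hc y = false)).filter
          (fun x' => Φ x' = true ∧ htm x' = htm x)).card : ℝ) /
      (((D.filter (fun y => hc y = false)).filter (fun x' => htm x' = htm x)).card : ℝ)) :
    ((∑ x ∈ D.filter (fun y => hc y = true), htp x) +
      ∑ x ∈ D.filter (fun y => hc y = false), (1 - htm x)) / (D.card : ℝ) =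
    ((D.filter (fun x => hc x = Φ x)).card : ℝ) / (D.card : ℝ) := by
  rw [Finset.sum_sub_distrib, calib_sum_aux _ Φ htp hcalp, calib_sum_aux _ Φ htm hcalm]
  congr 1
  simp only [Finset.filter_filter, Finset.sum_const, nsmul_eq_mul, mul_one,
    ← Finset.sum_boole]
  rw [← Finset.sum_sub_distrib, ← Finset.sum_add_distrib]
  refine Finset.sum_congr rfl fun x _ => ?_
  cases hc x <;> cases Φ x <;> simp
end

section
/- Let h : X → ℝ be a score function and define h̃ : X → ℝ on D by h̃(x) = |{x' ∈ D : Φ(x') = true and h(x') = h(x)}| / |{x' ∈ D : h(x') = h(x)}| (the prevalence of the equivalence class of x under equal h-scores). Then h̃ is perfectly calibrated with respect to D, i.e., for every x ∈ D, h̃(x) = |{x' ∈ D : Φ(x') = true and h̃(x') = h̃(x)}| / |{x' ∈ D : h̃(x') = h̃(x)}|. -/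
/-- Given a score function `h`, the function `ht` that assigns to each
`x ∈ D` the prevalence of positives among the points of `D` with the same `h`-score as
`x` is perfectly calibrated with respect to `D`. -/
theorem scoreClassPrevalence_isCalibrated {X : Type*} (D : Finset X) (hD : D.Nonempty)
    (Φ : X → Bool) (h ht : X → ℝ)
    (hdef : ∀ x ∈ D, ht x =
      ((D.filter (fun x' => Φ x' = true ∧ h x' = h x)).card : ℝ) /
      ((D.filter (fun x' => h x' = h x)).card : ℝ)) :
    ∀ x ∈ D, ht x =
      ((D.filter (fun x' => Φ x' = true ∧ ht x' = ht x)).card : ℝ) /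
      ((D.filter (fun x' => ht x' = ht x)).card : ℝ) := by
  intro x hx
  have hcongr : ∀ a ∈ D, ∀ b ∈ D, h a = h b → ht a = ht b := by
    intro a ha b hb hab
    rw [hdef a ha, hdef b hb, hab]
  have hpos : (0 : ℝ) < ((D.filter (fun x' => ht x' = ht x)).card : ℝ) := by
    exact_mod_cast Finset.card_pos.mpr ⟨x, by simp [hx]⟩
  rw [eq_div_iff hpos.ne']
  have e1 := Finset.card_eq_sum_card_fiberwise (f := h)
    (s := D.filter (fun x' => ht x' = ht x))
    (t := (D.filter (fun x' => ht x' = ht x)).image h)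
    (fun a ha => Finset.mem_coe.mpr (Finset.mem_image_of_mem h (Finset.mem_coe.mp ha)))
  have e2 := Finset.card_eq_sum_card_fiberwise (f := h)
    (s := D.filter (fun x' => Φ x' = true ∧ ht x' = ht x))
    (t := (D.filter (fun x' => ht x' = ht x)).image h)
    (fun a ha => by
      have ha' := Finset.mem_filter.mp (Finset.mem_coe.mp ha)
      exact Finset.mem_coe.mpr (Finset.mem_image_of_mem h
        (Finset.mem_filter.mpr ⟨ha'.1, ha'.2.2⟩)))
  rw [e1, e2]
  push_cast
  rw [Finset.mul_sum]
  refine Finset.sum_congr rfl fun v hv => ?_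
  obtain ⟨y, hy, rfl⟩ := Finset.mem_image.mp hv
  obtain ⟨hyD, hyx⟩ := Finset.mem_filter.mp hy
  have f1 : (D.filter (fun x' => ht x' = ht x)).filter (fun a => h a = h y)
      = D.filter (fun x' => h x' = h y) := by
    ext a
    simp only [Finset.mem_filter]
    constructor
    · rintro ⟨⟨p, _⟩, q⟩
      exact ⟨p, q⟩
    · rintro ⟨p, q⟩
      exact ⟨⟨p, (hcongr a p y hyD q).trans hyx⟩, q⟩
  have f2 : (D.filter (fun x' => Φ x' = true ∧ ht x' = ht x)).filter (fun a => h a = h y)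
      = D.filter (fun x' => Φ x' = true ∧ h x' = h y) := by
    ext a
    simp only [Finset.mem_filter]
    constructor
    · rintro ⟨⟨p, r, _⟩, q⟩
      exact ⟨p, r, q⟩
    · rintro ⟨p, r, q⟩
      exact ⟨⟨p, r, (hcongr a p y hyD q).trans hyx⟩, q⟩
  rw [f1, f2, ← hyx, hdef y hyD]
  have hp : (0 : ℝ) < ((D.filter (fun x' => h x' = h y)).card : ℝ) := by
    exact_mod_cast Finset.card_pos.mpr ⟨y, by simp [hyD]⟩
  exact div_mul_cancel₀ _ hp.ne'
end

section
/- Let h : X → ℝ be a score function, ĥ : X → Bool a crisp classifier, and split D into D⁺ = {x ∈ D : ĥ(x) = true} and D⁻ = {x ∈ D : ĥ(x) = false}. Define h̃⁺(x) = |{x' ∈ D⁺ : Φ(x') = true and h(x') = h(x)}| / |{x' ∈ D⁺ : h(x') = h(x)}| for x ∈ D⁺ and h̃⁻(x) = |{x' ∈ D⁻ : Φ(x') = true and h(x') = h(x)}| / |{x' ∈ D⁻ : h(x') = h(x)}| for x ∈ D⁻. Then (Σ_{x ∈ D⁺} h̃⁺(x) + Σ_{x ∈ D⁻} (1 − h̃⁻(x)))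 / |D| = |{x ∈ D : ĥ(x) = Φ(x)}| / |D|, i.e., the quantifier-based construction yields a perfect estimate of the classification accuracy of ĥ on D. -/
theorem sum_prev_aux {X : Type*} (S : Finset X) (Φ : X → Bool) (h : X → ℝ) :
    ∑ x ∈ S, ((S.filter (fun x' => Φ x' = true ∧ h x' = h x)).card : ℝ) /
      ((S.filter (fun x' => h x' = h x)).card : ℝ) =
    ((S.filter (fun x => Φ x = true)).card : ℝ) := by
  have h1 : ∀ x ∈ S, ((S.filter (fun x' => Φ x' = true ∧ h x' = h x)).card : ℝ) /
      ((S.filter (fun x' => h x' = h x)).card : ℝ) =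
      ∑ x' ∈ S, if Φ x' = true ∧ h x' = h x then
        (1 : ℝ) / ((S.filter (fun y => h y = h x')).card : ℝ) else 0 := by
    intro x _
    rw [← Finset.sum_filter, Finset.sum_congr rfl
      (g := fun _ => (1 : ℝ) / ((S.filter (fun y => h y = h x)).card : ℝ))]
    · rw [Finset.sum_const, nsmul_eq_mul, mul_one_div]
    · intro y hy
      rw [(Finset.mem_filter.1 hy).2.2]
  rw [Finset.sum_congr rfl h1, Finset.sum_comm, Finset.card_filter, Nat.cast_sum]
  refine Finset.sum_congr rfl fun x' hx' => ?_
  by_cases hp : Φ x' = true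
  · simp only [hp, true_and, if_true]
    rw [← Finset.sum_filter, Finset.sum_const, nsmul_eq_mul]
    have e : S.filter (fun x => h x' = h x) = S.filter (fun y => h y = h x') :=
      Finset.filter_congr fun y _ => eq_comm
    have hne : ((S.filter (fun y => h y = h x')).card : ℝ) ≠ 0 := by
      rw [Nat.cast_ne_zero, Finset.card_ne_zero]
      exact ⟨x', Finset.mem_filter.2 ⟨hx', rfl⟩⟩
    rw [e, mul_one_div_cancel hne]
    simp
  · simp [hp]

/-- Split `D` by the crisp classifier `hc` into predicted positives and
predicted negatives.  Define on each part the quantifier-based calibrated score (the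
prevalence of positives in the `h`-score equivalence class computed within the part);
then the resulting estimator equals the classification accuracy of `hc` on `D`.
Fractions with zero denominator are interpreted as `0` (Lean's convention). -/
theorem quantifier_estimator_eq_accuracy {X : Type*} (D : Finset X) (hD : D.Nonempty)
    (Φ : X → Bool) (h : X → ℝ) (hc : X → Bool) (htp htm : X → ℝ)
    (hdefp : ∀ x ∈ D.filter (fun y => hc y = true), htp x =
      (((D.filter (fun y => hc y = true)).filter
          (fun x' => Φ x' = true ∧ h x' = h x)).card : ℝ) /
      (((D.filter (fun y => hc y = true)).filter (fun x' => h x' = h x)).card : ℝ))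
    (hdefm : ∀ x ∈ D.filter (fun y => hc y = false), htm x =
      (((D.filter (fun y => hc y = false)).filter
          (fun x' => Φ x' = true ∧ h x' = h x)).card : ℝ) /
      (((D.filter (fun y => hc y = false)).filter (fun x' => h x' = h x)).card : ℝ)) :
    ((∑ x ∈ D.filter (fun y => hc y = true), htp x) +
      ∑ x ∈ D.filter (fun y => hc y = false), (1 - htm x)) / (D.card : ℝ) =
    ((D.filter (fun x => hc x = Φ x)).card : ℝ) / (D.card : ℝ) := by
  rw [Finset.sum_congr rfl hdefp, Finset.sum_sub_distrib, Finset.sum_congr rfl hdefm,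
    sum_prev_aux, sum_prev_aux]
  congr 1
  simp only [Finset.filter_filter, Finset.card_filter, Finset.sum_filter, Nat.cast_sum]
  rw [← Finset.sum_sub_distrib, ← Finset.sum_add_distrib]
  refine Finset.sum_congr rfl fun x _ => ?_
  cases hc x <;> cases Φ x <;> simp
end

section
/- Let h : X → ℝ be a score function and ĥ : X → Bool a crisp classifier. For x ∈ D let C(x) = {x' ∈ D : h(x') = h(x)}, C⁺(x) = {x' ∈ C(x) : ĥ(x') = true}, C⁻(x) = {x' ∈ C(x) : ĥ(x') = false}, and let a⁺(x) = |{x' ∈ C⁺(x) : ĥ(x') = Φ(x')}| / |C⁺(x)| and a⁻(x) = |{x' ∈ C⁻(x) : ĥ(x') = Φ(x')}| / |C⁻(x)| (fractions with zero denominator interpreted as 0). Define h̃(x) = a⁺(x) · |C⁺(x)|/|C(x)| + (1 − a⁻(x)) · |C⁻(x)|/|C(x)|. Then h̃ is perfectly calibrated with respect to D, i.e., for every x ∈ D, h̃(x) = |{x' ∈ D : Φ(x') = true and h̃(x') = h̃(x)}| / |{x' ∈ D : h̃(x') = h̃(x)}|. -/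
theorem aux_frac {X : Type*} (C : Finset X) (Φ hc : X → Bool) :
    (((C.filter (fun x' => hc x' = true)).filter (fun x' => hc x' = Φ x')).card : ℝ) /
        ((C.filter (fun x' => hc x' = true)).card : ℝ) *
        (((C.filter (fun x' => hc x' = true)).card : ℝ) / (C.card : ℝ)) +
      (1 - (((C.filter (fun x' => hc x' = false)).filter (fun x' => hc x' = Φ x')).card : ℝ) /
        ((C.filter (fun x' => hc x' = false)).card : ℝ)) *
        (((C.filter (fun x' => hc x' = false)).card : ℝ) / (C.card : ℝ)) =
      ((C.filter (fun x' => Φ x' = true)).card : ℝ) / (C.card : ℝ) := by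
  have key : ∀ (S T : Finset X), T ⊆ S →
      (T.card : ℝ) / (S.card : ℝ) * (S.card : ℝ) = T.card := by
    intro S T hTS
    rcases Nat.eq_zero_or_pos S.card with h0 | h0
    · have h1 := Finset.card_le_card hTS
      have h2 : T.card = 0 := by omega
      simp [h0, h2]
    · have : (S.card : ℝ) ≠ 0 := by positivity
      field_simp
  have k1 := key _ _ (Finset.filter_subset (fun x' => hc x' = Φ x')
    (C.filter (fun x' => hc x' = true)))
  have k2 := key _ _ (Finset.filter_subset (fun x' => hc x' = Φ x')
    (C.filter (fun x' => hc x' = false)))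
  have e1 := Finset.card_filter_add_card_filter_not (s := C.filter (fun x' => hc x' = false))
    (fun x' => hc x' = Φ x')
  have e2 := Finset.card_filter_add_card_filter_not (s := C.filter (fun x' => Φ x' = true))
    (fun x' => hc x' = true)
  have f1 : (C.filter (fun x' => Φ x' = true)).filter (fun x' => hc x' = true) =
      (C.filter (fun x' => hc x' = true)).filter (fun x' => hc x' = Φ x') := by
    ext y; simp only [Finset.mem_filter]; grind
  have f2 : (C.filter (fun x' => Φ x' = true)).filter (fun x' => ¬ hc x' = true) =
      (C.filter (fun x' => hc x' = false)).filter (fun x' => ¬ hc x' = Φ x') := by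
    ext y; simp only [Finset.mem_filter]
    cases hc y <;> cases Φ y <;> simp
  rw [f1, f2] at e2
  have e1' := congrArg (Nat.cast : ℕ → ℝ) e1
  have e2' := congrArg (Nat.cast : ℕ → ℝ) e2
  push_cast at e1' e2'
  rw [← mul_div_assoc, ← mul_div_assoc, ← add_div, sub_mul, k1, k2]
  congr 1
  linarith

/-- For `x ∈ D` let `C x` be the `h`-score equivalence class of `x` in
`D`, split it by the crisp classifier `hc` into `C⁺ x` and `C⁻ x`, and let `a⁺ x`, `a⁻ x`
be the accuracies of `hc` on these parts (fractions with zero denominator interpreted as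
`0`, Lean's convention).  The function
`ht x = a⁺ x · |C⁺ x|/|C x| + (1 − a⁻ x) · |C⁻ x|/|C x|` is perfectly calibrated with
respect to `D`. -/
theorem accuracy_based_calibrator_isCalibrated {X : Type*} (D : Finset X)
    (hD : D.Nonempty) (Φ : X → Bool) (h : X → ℝ) (hc : X → Bool) (ht : X → ℝ)
    (hdef : ∀ x ∈ D, ht x =
      ((((D.filter (fun x' => h x' = h x)).filter (fun x' => hc x' = true)).filter
          (fun x' => hc x' = Φ x')).card : ℝ) /
        (((D.filter (fun x' => h x' = h x)).filter (fun x' => hc x' = true)).card : ℝ) *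
        ((((D.filter (fun x' => h x' = h x)).filter (fun x' => hc x' = true)).card : ℝ) /
          ((D.filter (fun x' => h x' = h x)).card : ℝ)) +
      (1 - ((((D.filter (fun x' => h x' = h x)).filter (fun x' => hc x' = false)).filter
          (fun x' => hc x' = Φ x')).card : ℝ) /
        (((D.filter (fun x' => h x' = h x)).filter (fun x' => hc x' = false)).card : ℝ)) *
        ((((D.filter (fun x' => h x' = h x)).filter (fun x' => hc x' = false)).card : ℝ) /
          ((D.filter (fun x' => h x' = h x)).card : ℝ))) :
    ∀ x ∈ D, ht x =
      ((D.filter (fun x' => Φ x' = true ∧ ht x' = ht x)).card : ℝ) /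
      ((D.filter (fun x' => ht x' = ht x)).card : ℝ) := by
  intro x hx
  simp only [aux_frac] at hdef
  have hconst : ∀ y ∈ D, ∀ z ∈ D, h y = h z → ht y = ht z := by
    intro y hy z hz e
    rw [hdef y hy, hdef z hz, e]
  have hmul : ∀ y ∈ D, ht y * ((D.filter (fun x' => h x' = h y)).card : ℝ) =
      (((D.filter (fun x' => h x' = h y)).filter (fun x' => Φ x' = true)).card : ℝ) := by
    intro y hy
    have hpos : 0 < (D.filter (fun x' => h x' = h y)).card :=
      Finset.card_pos.mpr ⟨y, by simp [hy]⟩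
    have : ((D.filter (fun x' => h x' = h y)).card : ℝ) ≠ 0 := by positivity
    rw [hdef y hy, div_mul_cancel₀ _ this]
  have hpos : 0 < (D.filter (fun x' => ht x' = ht x)).card :=
    Finset.card_pos.mpr ⟨x, by simp [hx]⟩
  have hne : ((D.filter (fun x' => ht x' = ht x)).card : ℝ) ≠ 0 := by positivity
  rw [eq_div_iff hne]
  have c1 := Finset.card_eq_sum_card_fiberwise (f := h)
    (s := D.filter (fun x' => ht x' = ht x))
    (t := (D.filter (fun x' => ht x' = ht x)).image h)
    (fun y hy => Finset.mem_coe.mpr (Finset.mem_image_of_mem h hy))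
  have c2 := Finset.card_eq_sum_card_fiberwise (f := h)
    (s := D.filter (fun x' => Φ x' = true ∧ ht x' = ht x))
    (t := (D.filter (fun x' => ht x' = ht x)).image h)
    (fun y hy => Finset.mem_coe.mpr (Finset.mem_image_of_mem h (by
      have hy' := Finset.mem_filter.mp (Finset.mem_coe.mp hy)
      exact Finset.mem_filter.mpr ⟨hy'.1, hy'.2.2⟩)))
  rw [c1, c2]
  push_cast
  rw [Finset.mul_sum]
  refine Finset.sum_congr rfl fun v hv => ?_
  obtain ⟨y, hy, rfl⟩ := Finset.mem_image.mp hv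
  obtain ⟨hyD, hyx⟩ := Finset.mem_filter.mp hy
  have g1 : (D.filter (fun x' => ht x' = ht x)).filter (fun x' => h x' = h y) =
      D.filter (fun x' => h x' = h y) := by
    ext z; simp only [Finset.mem_filter]
    exact ⟨fun q => ⟨q.1.1, q.2⟩, fun q => ⟨⟨q.1, (hconst z q.1 y hyD q.2).trans hyx⟩, q.2⟩⟩
  have g2 : (D.filter (fun x' => Φ x' = true ∧ ht x' = ht x)).filter (fun x' => h x' = h y) =
      (D.filter (fun x' => h x' = h y)).filter (fun x' => Φ x' = true) := by
    ext z; simp only [Finset.mem_filter]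
    exact ⟨fun q => ⟨⟨q.1.1, q.2⟩, q.1.2.1⟩,
      fun q => ⟨⟨q.1.1, q.2, (hconst z q.1.1 y hyD q.1.2).trans hyx⟩, q.1.2⟩⟩
  rw [g1, g2, ← hyx]
  exact hmul y hyD
end
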